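/- For any θ, θ', θ̃ ∈ Θ and any M ≥ 1, the backward-sampling average of acceptance ratio estimates is an unbiased estimator of the marginal Metropolis–Hastings acceptance ratio: ∫_{Z^T} π_θ(dz) ∫_{Z^{MT}} Φ_{θ̃}(z, dζ) Σ_{k∈{1,…,M}^T} φ_{θ̃}(k | ζ) r̊_{z, ζ^{(k)}}(θ, θ'; θ̃) = r(θ, θ'); that is, if z ∼ π_θ and, given z, ζ is generated by the conditional SMC algorithm with M particles at parameter θ̃ conditioned on z, then E[ Σ_k φ_{θ̃}(k|ζ) r̊_{z,ζ^{(k)}}(θ,θ';θ̃) ] = r(θ,θ'). -/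

import Mathlib

open MeasureTheory ProbabilityTheory
open scoped ENNReal

noncomputable section

namespace CSMCUnbiased

variable {Z : Type*} [MeasurableSpace Z] {Th : Type*}

/-- Unnormalised posterior density
`γ_θ(z) = μ_θ(z₁) ∏_t f_θ(z_{t-1}, z_t) ∏_t w_{θ,t}(z_t)` on `Z^{n+1}`. -/
def gam {n : ℕ} (μd : Th → Z → ℝ) (f : Th → Z → Z → ℝ)
    (w : Th → Fin (n + 1) → Z → ℝ) (θ : Th) (z : Fin (n + 1) → Z) : ℝ :=
  μd θ (z 0) * (∏ s : Fin n, f θ (z s.castSucc) (z s.succ))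
    * ∏ t : Fin (n + 1), w θ t (z t)

/-- The posterior `π_θ = ℓ_θ⁻¹ γ_θ ⬝ λ^{⊗(n+1)}`. -/
def post (lam : Measure Z) {n : ℕ} (μd : Th → Z → ℝ) (f : Th → Z → Z → ℝ)
    (w : Th → Fin (n + 1) → Z → ℝ) (L : Th → ℝ≥0∞) (θ : Th) :
    Measure (Fin (n + 1) → Z) :=
  (Measure.pi (fun _ : Fin (n + 1) => lam)).withDensity
    (fun z => ENNReal.ofReal (gam μd f w θ z) / L θ)

/-- Base measure of the conditional SMC particles at parameter `θ` given reference path `z`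
and slots `k`: particle `(t, k_t)` is frozen at `z_t`, the others carry `μ_θ = μd θ ⬝ λ`
(at `t = 0`) or `λ`. -/
def condBase (lam : Measure Z) {n M : ℕ} (μd : Th → Z → ℝ) (θ : Th)
    (z : Fin (n + 1) → Z) (k : Fin (n + 1) → Fin M) :
    Measure (Fin (n + 1) → Fin M → Z) :=
  Measure.pi (fun t => Measure.pi (fun i =>
    if i = k t then Measure.dirac (z t)
    else if t = 0 then lam.withDensity (fun x => ENNReal.ofReal (μd θ x)) else lam))

/-- Density of the conditional SMC transitions at parameter `θ` (free particles only). -/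
def condDens {n M : ℕ} (f : Th → Z → Z → ℝ) (w : Th → Fin (n + 1) → Z → ℝ) (θ : Th)
    (k : Fin (n + 1) → Fin M) (ζ : Fin (n + 1) → Fin M → Z) : ℝ≥0∞ :=
  ∏ s : Fin n, ∏ i : Fin M,
    if i = k s.succ then 1 else
      (∑ j : Fin M, ENNReal.ofReal (w θ s.castSucc (ζ s.castSucc j))
          * ENNReal.ofReal (f θ (ζ s.castSucc j) (ζ s.succ i)))
        / ∑ j : Fin M, ENNReal.ofReal (w θ s.castSucc (ζ s.castSucc j))

/-- The conditional SMC law `Φ_θ(z, dζ)` of the particles (slots marginalised out). -/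
def csmcLaw (lam : Measure Z) (M : ℕ) {n : ℕ} (μd : Th → Z → ℝ) (f : Th → Z → Z → ℝ)
    (w : Th → Fin (n + 1) → Z → ℝ) (θ : Th) (z : Fin (n + 1) → Z) :
    Measure (Fin (n + 1) → Fin M → Z) :=
  ∑ k : Fin (n + 1) → Fin M, (((M : ℝ≥0∞) ^ (n + 1))⁻¹) •
    ((condBase lam μd θ z k).withDensity (condDens f w θ k))

/-- The backward-sampling probability `φ_θ(k ∣ ζ)`. -/
def bsProb {n M : ℕ} (f : Th → Z → Z → ℝ) (w : Th → Fin (n + 1) → Z → ℝ) (θ : Th)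
    (k : Fin (n + 1) → Fin M) (ζ : Fin (n + 1) → Fin M → Z) : ℝ≥0∞ :=
  (ENNReal.ofReal (w θ (Fin.last n) (ζ (Fin.last n) (k (Fin.last n))))
      / ∑ i : Fin M, ENNReal.ofReal (w θ (Fin.last n) (ζ (Fin.last n) i)))
    * ∏ s : Fin n,
      (ENNReal.ofReal (w θ s.castSucc (ζ s.castSucc (k s.castSucc)))
          * ENNReal.ofReal (f θ (ζ s.castSucc (k s.castSucc)) (ζ s.succ (k s.succ))))
        / ∑ i : Fin M, ENNReal.ofReal (w θ s.castSucc (ζ s.castSucc i))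
            * ENNReal.ofReal (f θ (ζ s.castSucc i) (ζ s.succ (k s.succ)))

/-- The acceptance-ratio estimate
`r̊_{z,z'}(θ,θ';θ̃) = [q(θ',θ)η(θ')γ_{θ'}(z')γ_{θ̃}(z)] / [q(θ,θ')η(θ)γ_{θ̃}(z')γ_θ(z)]`. -/
def rEst {n : ℕ} (μd : Th → Z → ℝ) (f : Th → Z → Z → ℝ)
    (w : Th → Fin (n + 1) → Z → ℝ) (qp : Th → Th → ℝ) (ηp : Th → ℝ)
    (θ θ' θt : Th) (z z' : Fin (n + 1) → Z) : ℝ :=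
  (qp θ' θ * ηp θ' * gam μd f w θ' z' * gam μd f w θt z)
    / (qp θ θ' * ηp θ * gam μd f w θt z' * gam μd f w θ z)


/-- Insert the path `p.1` at the slots `k` into the free particles `p.2`. -/
def insertPath {n m : ℕ} (k : Fin (n + 1) → Fin (m + 1))
    (p : (Fin (n + 1) → Z) × (Fin (n + 1) → Fin m → Z)) : Fin (n + 1) → Fin (m + 1) → Z :=
  fun t => (k t).insertNth (p.1 t) (p.2 t)

lemma pi_dirac {ι : Type*} [Fintype ι] (z : ι → Z) :
    Measure.pi (fun i => Measure.dirac (z i)) = Measure.dirac z := by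
  refine Measure.pi_eq fun s hs => ?_
  rw [Measure.dirac_apply' _ (MeasurableSet.univ_pi hs)]
  simp only [Measure.dirac_apply' _ (hs _)]
  by_cases h : z ∈ Set.univ.pi s
  · have h' : ∀ i, z i ∈ s i := fun i => h i (Set.mem_univ i)
    simp [h, h']
  · obtain ⟨i, hi⟩ : ∃ i, z i ∉ s i := by simpa [Set.mem_pi] using h
    rw [Finset.prod_eq_zero (Finset.mem_univ i) (by simp [hi])]
    simp [h]

lemma measurePreserving_insertPath {n m : ℕ} (k : Fin (n + 1) → Fin (m + 1))
    (α ν : Fin (n + 1) → Measure Z) [∀ t, SigmaFinite (α t)] [∀ t, SigmaFinite (ν t)] :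
    MeasurePreserving (insertPath k)
      ((Measure.pi α).prod (Measure.pi fun t => Measure.pi fun _ : Fin m => ν t))
      (Measure.pi fun t => Measure.pi fun i => if i = k t then α t else ν t) := by
  have hσ : ∀ t i, SigmaFinite (if i = k t then α t else ν t) := fun t i => by
    split_ifs <;> infer_instance
  have h1 := (measurePreserving_arrowProdEquivProdArrow Z (Fin m → Z) (Fin (n + 1)) α
    (fun t => Measure.pi fun _ : Fin m => ν t)).symm
  refine MeasurePreserving.comp (g := fun (a : Fin (n + 1) → Z × (Fin m → Z)) t =>
    (MeasurableEquiv.piFinSuccAbove (fun _ => Z) (k t)).symm (a t)) ?_ h1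
  refine measurePreserving_pi _ _ fun t => ?_
  have h2 := (measurePreserving_piFinSuccAbove
    (fun i => if i = k t then α t else ν t) (k t)).symm
  simpa [Fin.succAbove_ne] using h2

lemma lintegral_pi_prod {n : ℕ} (ν : Fin n → Measure Z) [∀ i, SigmaFinite (ν i)]
    (g : Fin n → Z → ℝ≥0∞) (hg : ∀ i, Measurable (g i)) :
    ∫⁻ y, ∏ i, g i (y i) ∂(Measure.pi ν) = ∏ i, ∫⁻ x, g i x ∂(ν i) := by
  induction n with
  | zero => simp
  | succ n ih =>
    rw [← (measurePreserving_piFinSuccAbove ν 0).symm.lintegral_comp_emb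
      (MeasurableEquiv.measurableEmbedding _)]
    simp only [MeasurableEquiv.piFinSuccAbove_symm_apply, Fin.insertNthEquiv, Equiv.coe_fn_mk,
      Fin.prod_univ_succ, Fin.insertNth_zero', Fin.cons_zero, Fin.cons_succ, Fin.zero_succAbove]
    rw [lintegral_prod_mul (g := fun u : Fin n → Z => ∏ i : Fin n, g i.succ (u i))
      (hg 0).aemeasurable
      (Finset.measurable_prod _ fun i _ =>
        (hg (Fin.succ i)).comp (measurable_pi_apply i)).aemeasurable,
      ih (fun i => ν i.succ) (fun i => g i.succ) fun i => hg _]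

lemma lintegral_pi_chain_eq_one {X : Type*} [MeasurableSpace X] {n : ℕ}
    (ν : Fin (n + 1) → Measure X) [∀ t, SigmaFinite (ν t)] (hν : ν 0 Set.univ = 1)
    (p : Fin n → X → X → ℝ≥0∞) (hpm : ∀ s, Measurable (Function.uncurry (p s)))
    (hp : ∀ s x, ∫⁻ y, p s x y ∂(ν s.succ) = 1) :
    ∫⁻ x, ∏ s : Fin n, p s (x s.castSucc) (x s.succ) ∂(Measure.pi ν) = 1 := by
  induction n with
  | zero => simp [Measure.pi_univ, hν]
  | succ n ih =>
    have hm : Measurable fun x : Fin (n + 2) → X => ∏ s, p s (x s.castSucc) (x s.succ) :=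
      Finset.measurable_prod _ fun s _ => (hpm s).comp (f := fun x : Fin (n + 2) → X =>
        (x s.castSucc, x s.succ)) (by fun_prop)
    have e := (measurePreserving_piFinSuccAbove ν (Fin.last (n + 1))).symm
    rw [← e.lintegral_comp hm, lintegral_prod_symm _
      (by simpa only [Function.comp_def] using (hm.comp e.measurable).aemeasurable),
      ← ih (fun t => ν t.castSucc) hν (fun s => p s.castSucc) (fun s => hpm _)
        fun s x => by simpa using! hp s.castSucc x]
    simp only [Fin.succAbove_last]
    refine lintegral_congr fun x => ?_
    simp only [MeasurableEquiv.piFinSuccAbove_symm_apply, Fin.insertNthEquiv, Equiv.coe_fn_mk,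
      Fin.insertNth_last', Fin.prod_univ_castSucc, Fin.snoc_castSucc, Fin.succ_castSucc,
      Fin.succ_last, Fin.snoc_last]
    have hpx : Measurable (p (Fin.last n) (x (Fin.last n))) := by
      have := hpm (Fin.last n)
      fun_prop
    rw [lintegral_const_mul _ hpx]
    have := hp (Fin.last n) (x (Fin.last n))
    rw [Fin.succ_last] at this
    rw [this, mul_one]

lemma lintegral_pi_withDensity_zero (lam : Measure Z) [SigmaFinite lam] {n : ℕ} (g : Z → ℝ≥0∞)
    (hg : Measurable g) [SigmaFinite (lam.withDensity g)]
    (F : (Fin (n + 1) → Z) → ℝ≥0∞) (hF : Measurable F) :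
    ∫⁻ z, F z ∂(Measure.pi fun t : Fin (n + 1) => if t = 0 then lam.withDensity g else lam)
      = ∫⁻ z, g (z 0) * F z ∂(Measure.pi fun _ : Fin (n + 1) => lam) := by
  have hσ : ∀ t : Fin (n + 1), SigmaFinite (if t = 0 then lam.withDensity g else lam) := fun t => by
    split_ifs <;> infer_instance
  have e := (measurePreserving_piFinSuccAbove
    (fun t : Fin (n + 1) => if t = 0 then lam.withDensity g else lam) 0).symm
  have e' := (measurePreserving_piFinSuccAbove (fun _ : Fin (n + 1) => lam) 0).symm
  have hgF : Measurable fun z : Fin (n + 1) → Z => g (z 0) * F z :=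
    (hg.comp (measurable_pi_apply 0)).mul hF
  rw [← e.lintegral_comp hF, ← e'.lintegral_comp hgF]
  simp only [if_true, Fin.zero_succAbove, Fin.succ_ne_zero, if_false]
  rw [prod_withDensity_left hg, lintegral_withDensity_eq_lintegral_mul _ (f := fun a => g a.1)
    (hg.comp (f := Prod.fst (β := Fin n → Z)) measurable_fst)
    (g := fun a => F ((MeasurableEquiv.piFinSuccAbove (fun _ : Fin (n + 1) => Z) 0).symm a))
    (hF.comp (MeasurableEquiv.measurable _))]
  refine lintegral_congr fun x => ?_
  simp [MeasurableEquiv.piFinSuccAbove_symm_apply, Fin.insertNthEquiv]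

lemma sum_chain_eq {M n : ℕ} (p : Fin M → ℝ≥0∞) (b : Fin n → Fin M → Fin M → ℝ≥0∞)
    (hb : ∀ s i, ∑ j, b s j i = 1) :
    ∑ k : Fin (n + 1) → Fin M, p (k (Fin.last n)) * ∏ s, b s (k s.castSucc) (k s.succ)
      = ∑ i, p i := by
  induction n with
  | zero =>
    exact Fintype.sum_equiv (Equiv.funUnique (Fin 1) (Fin M)) _ _ fun k => by simp
  | succ n ih =>
    rw [← ih (fun s => b s.succ) fun s => hb _,
      ← (Fin.consEquiv fun _ : Fin (n + 2) => Fin M).sum_comp, Fintype.sum_prod_type_right]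
    refine Finset.sum_congr rfl fun k _ => ?_
    simp only [Fin.consEquiv, Equiv.coe_fn_mk, Fin.prod_univ_succ, Fin.castSucc_zero,
      Fin.cons_zero, Fin.cons_succ, ← Fin.succ_castSucc, ← Fin.succ_last]
    rw [← Finset.mul_sum, ← Finset.sum_mul, hb, one_mul]

lemma measurable_condDens {n M : ℕ} (f : Th → Z → Z → ℝ) (w : Th → Fin (n + 1) → Z → ℝ) (θ : Th)
    (hfm : Measurable (Function.uncurry (f θ))) (hwm : ∀ t, Measurable (w θ t))
    (k : Fin (n + 1) → Fin M) : Measurable (condDens f w θ k) := by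
  unfold condDens
  refine Finset.measurable_prod _ fun s _ => Finset.measurable_prod _ fun i _ => ?_
  split_ifs
  · exact measurable_const
  · have := hwm
    fun_prop

lemma measurable_bsProb {n M : ℕ} (f : Th → Z → Z → ℝ) (w : Th → Fin (n + 1) → Z → ℝ) (θ : Th)
    (hfm : Measurable (Function.uncurry (f θ))) (hwm : ∀ t, Measurable (w θ t))
    (k : Fin (n + 1) → Fin M) : Measurable (bsProb f w θ k) := by
  unfold bsProb
  fun_prop

lemma measurable_gam {n : ℕ} (μd : Th → Z → ℝ) (f : Th → Z → Z → ℝ)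
    (w : Th → Fin (n + 1) → Z → ℝ) (θ : Th) (hμdm : Measurable (μd θ))
    (hfm : Measurable (Function.uncurry (f θ))) (hwm : ∀ t, Measurable (w θ t)) :
    Measurable (gam μd f w θ) := by
  unfold gam
  fun_prop

lemma gam_pos {Z Th : Type*} {n : ℕ} (μd : Th → Z → ℝ) (f : Th → Z → Z → ℝ)
    (w : Th → Fin (n + 1) → Z → ℝ) (θ : Th) (hμdpos : ∀ x, 0 < μd θ x)
    (hfpos : ∀ x y, 0 < f θ x y) (hwpos : ∀ t x, 0 < w θ t x) (z : Fin (n + 1) → Z) :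
    0 < gam μd f w θ z :=
  mul_pos (mul_pos (hμdpos _) (Finset.prod_pos fun _ _ => hfpos _ _))
    (Finset.prod_pos fun _ _ => hwpos _ _)

/-- The factor `∏_s f_θ(z_{s-1}, z_s) ∏_t w_{θ,t}(z_t)` of the unnormalised posterior density. -/
def pathWeight {n : ℕ} (f : Th → Z → Z → ℝ) (w : Th → Fin (n + 1) → Z → ℝ) (θ : Th)
    (z : Fin (n + 1) → Z) : ℝ≥0∞ :=
  (∏ s : Fin n, ENNReal.ofReal (f θ (z s.castSucc) (z s.succ)))
    * ∏ t : Fin (n + 1), ENNReal.ofReal (w θ t (z t))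

lemma measurable_pathWeight {n : ℕ} (f : Th → Z → Z → ℝ) (w : Th → Fin (n + 1) → Z → ℝ) (θ : Th)
    (hfm : Measurable (Function.uncurry (f θ))) (hwm : ∀ t, Measurable (w θ t)) :
    Measurable (pathWeight f w θ) := by
  unfold pathWeight
  fun_prop

lemma ofReal_gam {Z Th : Type*} {n : ℕ} (μd : Th → Z → ℝ) (f : Th → Z → Z → ℝ)
    (w : Th → Fin (n + 1) → Z → ℝ) (θ : Th) (hμdpos : ∀ x, 0 < μd θ x)
    (hfpos : ∀ x y, 0 < f θ x y) (hwpos : ∀ t x, 0 < w θ t x) (z : Fin (n + 1) → Z) :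
    ENNReal.ofReal (gam μd f w θ z) = ENNReal.ofReal (μd θ (z 0)) * pathWeight f w θ z := by
  have hf : 0 ≤ ∏ s : Fin n, f θ (z s.castSucc) (z s.succ) :=
    Finset.prod_nonneg fun _ _ => (hfpos _ _).le
  rw [gam, pathWeight, ENNReal.ofReal_mul (mul_nonneg (hμdpos _).le hf),
    ENNReal.ofReal_mul (hμdpos _).le, ENNReal.ofReal_prod_of_nonneg fun _ _ => (hfpos _ _).le,
    ENNReal.ofReal_prod_of_nonneg fun _ _ => (hwpos _ _).le, mul_assoc]

/-- The density of all particles in the unconditional SMC algorithm, weighted by the unnormalised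
likelihood estimate. -/
def smcWeight {n M : ℕ} (f : Th → Z → Z → ℝ) (w : Th → Fin (n + 1) → Z → ℝ) (θ : Th)
    (ζ : Fin (n + 1) → Fin M → Z) : ℝ≥0∞ :=
  (∏ s : Fin n, ∏ i : Fin M,
      (∑ j : Fin M, ENNReal.ofReal (w θ s.castSucc (ζ s.castSucc j))
          * ENNReal.ofReal (f θ (ζ s.castSucc j) (ζ s.succ i)))
        / ∑ j : Fin M, ENNReal.ofReal (w θ s.castSucc (ζ s.castSucc j)))
    * ∏ t : Fin (n + 1), ∑ j : Fin M, ENNReal.ofReal (w θ t (ζ t j))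

lemma measurable_smcWeight {n M : ℕ} (f : Th → Z → Z → ℝ) (w : Th → Fin (n + 1) → Z → ℝ) (θ : Th)
    (hfm : Measurable (Function.uncurry (f θ))) (hwm : ∀ t, Measurable (w θ t)) :
    Measurable (smcWeight (M := M) f w θ) := by
  unfold smcWeight
  fun_prop

lemma sum_ofReal_ne_zero {M : ℕ} (i : Fin M) (a : Fin M → ℝ) (ha : ∀ j, 0 < a j) :
    ∑ j, ENNReal.ofReal (a j) ≠ 0 := fun h =>
  (ENNReal.ofReal_pos.2 (ha i)).ne' (Finset.sum_eq_zero_iff.1 h i (Finset.mem_univ i))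

lemma prod_chain_cancel {n : ℕ} (F : Fin n → ℝ≥0∞) (V : Fin (n + 1) → ℝ≥0∞) (c S : Fin n → ℝ≥0∞)
    (W : Fin (n + 1) → ℝ≥0∞) (hS : ∀ s, S s ≠ 0) (hS' : ∀ s, S s ≠ ⊤)
    (hW : ∀ t, W t ≠ 0) (hW' : ∀ t, W t ≠ ⊤) :
    ((∏ s, F s) * ∏ t, V t) * ∏ s, c s
      = ((∏ s, (S s / W s.castSucc * c s)) * ∏ t, W t)
        * (V (Fin.last n) / W (Fin.last n) * ∏ s, V s.castSucc * F s / S s) := by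
  have h : ∀ s, F s * V s.castSucc * c s
      = (S s / W s.castSucc * c s) * W s.castSucc * (V s.castSucc * F s / S s) := fun s => by
    calc F s * V s.castSucc * c s
        = (S s * (S s)⁻¹) * (W s.castSucc * (W s.castSucc)⁻¹) * (F s * V s.castSucc * c s) := by
          rw [ENNReal.mul_inv_cancel (hS s) (hS' s), ENNReal.mul_inv_cancel (hW _) (hW' _),
            one_mul, one_mul]
      _ = _ := by simp only [div_eq_mul_inv]; ring
  have hlast : V (Fin.last n) = W (Fin.last n) * (V (Fin.last n) / W (Fin.last n)) :=
    (ENNReal.mul_div_cancel (hW _) (hW' _)).symm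
  have hprod := Finset.prod_congr (rfl : (Finset.univ : Finset (Fin n)) = _) fun s _ => h s
  simp only [Finset.prod_mul_distrib] at hprod
  rw [Fin.prod_univ_castSucc V, Fin.prod_univ_castSucc W]
  simp only [Finset.prod_mul_distrib]
  calc _ = ((∏ s, F s) * (∏ s : Fin n, V s.castSucc) * ∏ s, c s) * V (Fin.last n) := by ring
    _ = _ := by rw [hprod]; nth_rw 1 [hlast]; ring

lemma pathWeight_mul_condDens {Z Th : Type*} {n M : ℕ} (f : Th → Z → Z → ℝ)
    (w : Th → Fin (n + 1) → Z → ℝ)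
    (θ : Th) (hfpos : ∀ x y, 0 < f θ x y) (hwpos : ∀ t x, 0 < w θ t x)
    (k : Fin (n + 1) → Fin M) (ζ : Fin (n + 1) → Fin M → Z) :
    pathWeight f w θ (fun t => ζ t (k t)) * condDens f w θ k ζ
      = smcWeight f w θ ζ * bsProb f w θ k ζ := by
  have hW : ∀ t, ∑ j, ENNReal.ofReal (w θ t (ζ t j)) ≠ 0 := fun t =>
    sum_ofReal_ne_zero (k t) _ fun j => hwpos _ _
  have hW' : ∀ t, ∑ j, ENNReal.ofReal (w θ t (ζ t j)) ≠ ⊤ := fun t =>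
    ENNReal.sum_ne_top.2 fun _ _ => ENNReal.ofReal_ne_top
  have hS : ∀ (s : Fin n) y, ∑ j, ENNReal.ofReal (w θ s.castSucc (ζ s.castSucc j))
      * ENNReal.ofReal (f θ (ζ s.castSucc j) y) ≠ 0 := fun s y => by
    simp only [← ENNReal.ofReal_mul (hwpos _ _).le]
    exact sum_ofReal_ne_zero (k s.castSucc) _ fun j => mul_pos (hwpos _ _) (hfpos _ _)
  have hS' : ∀ (s : Fin n) y, ∑ j, ENNReal.ofReal (w θ s.castSucc (ζ s.castSucc j))
      * ENNReal.ofReal (f θ (ζ s.castSucc j) y) ≠ ⊤ := fun s y =>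
    ENNReal.sum_ne_top.2 fun _ _ => ENNReal.mul_ne_top ENNReal.ofReal_ne_top ENNReal.ofReal_ne_top
  have hsplit : ∀ (i₀ : Fin M) (Q : Fin M → ℝ≥0∞),
      ∏ i, Q i = Q i₀ * ∏ i, if i = i₀ then 1 else Q i := fun i₀ Q => by
    rw [← Finset.mul_prod_erase _ Q (Finset.mem_univ i₀),
      ← Finset.mul_prod_erase _ (fun i => if i = i₀ then 1 else Q i) (Finset.mem_univ i₀)]
    simp only [if_true, one_mul]
    congr 1
    exact Finset.prod_congr rfl fun i hi => by simp [Finset.ne_of_mem_erase hi]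
  simp only [pathWeight, condDens, smcWeight, bsProb]
  have hQ := fun s : Fin n => hsplit (k s.succ) fun i =>
    (∑ j : Fin M, ENNReal.ofReal (w θ s.castSucc (ζ s.castSucc j))
      * ENNReal.ofReal (f θ (ζ s.castSucc j) (ζ s.succ i)))
        / ∑ j : Fin M, ENNReal.ofReal (w θ s.castSucc (ζ s.castSucc j))
  rw [Finset.prod_congr (rfl : (Finset.univ : Finset (Fin n)) = _) fun s _ => hQ s]
  exact prod_chain_cancel
    (fun s => ENNReal.ofReal (f θ (ζ s.castSucc (k s.castSucc)) (ζ s.succ (k s.succ))))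
    (fun t => ENNReal.ofReal (w θ t (ζ t (k t))))
    (fun s => ∏ i : Fin M, if i = k s.succ then 1 else
      (∑ j : Fin M, ENNReal.ofReal (w θ s.castSucc (ζ s.castSucc j))
        * ENNReal.ofReal (f θ (ζ s.castSucc j) (ζ s.succ i)))
          / ∑ j : Fin M, ENNReal.ofReal (w θ s.castSucc (ζ s.castSucc j)))
    (fun s => ∑ j, ENNReal.ofReal (w θ s.castSucc (ζ s.castSucc j))
      * ENNReal.ofReal (f θ (ζ s.castSucc j) (ζ s.succ (k s.succ))))
    (fun t => ∑ j, ENNReal.ofReal (w θ t (ζ t j)))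
    (fun s => hS s _) (fun s => hS' s _) hW hW'

lemma sum_bsProb {Z Th : Type*} {n M : ℕ} (hM : 1 ≤ M) (f : Th → Z → Z → ℝ)
    (w : Th → Fin (n + 1) → Z → ℝ)
    (θ : Th) (hfpos : ∀ x y, 0 < f θ x y) (hwpos : ∀ t x, 0 < w θ t x)
    (ζ : Fin (n + 1) → Fin M → Z) :
    ∑ k, bsProb f w θ k ζ = 1 := by
  have normalise : ∀ a : Fin M → ℝ, (∀ j, 0 < a j) →
      ∑ j, ENNReal.ofReal (a j) / ∑ i, ENNReal.ofReal (a i) = 1 := fun a ha => by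
    simp only [div_eq_mul_inv]
    rw [← Finset.sum_mul]
    exact ENNReal.mul_inv_cancel (sum_ofReal_ne_zero ⟨0, hM⟩ a ha)
      (ENNReal.sum_ne_top.2 fun _ _ => ENNReal.ofReal_ne_top)
  refine (sum_chain_eq
    (fun i => ENNReal.ofReal (w θ (Fin.last n) (ζ (Fin.last n) i))
      / ∑ i : Fin M, ENNReal.ofReal (w θ (Fin.last n) (ζ (Fin.last n) i)))
    (fun s j i => (ENNReal.ofReal (w θ s.castSucc (ζ s.castSucc j))
          * ENNReal.ofReal (f θ (ζ s.castSucc j) (ζ s.succ i)))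
        / ∑ j : Fin M, ENNReal.ofReal (w θ s.castSucc (ζ s.castSucc j))
            * ENNReal.ofReal (f θ (ζ s.castSucc j) (ζ s.succ i))) fun s i => ?_).trans ?_
  · simp only [← ENNReal.ofReal_mul (hwpos _ _).le]
    exact normalise _ fun j => mul_pos (hwpos _ _) (hfpos _ _)
  · exact normalise _ fun j => hwpos _ _

/-- The reference measure of a free particle at time `t`. -/
def freeMeasure (lam : Measure Z) {n : ℕ} (μd : Th → Z → ℝ) (θ : Th) (t : Fin (n + 1)) :
    Measure Z :=
  if t = 0 then lam.withDensity (fun x => ENNReal.ofReal (μd θ x)) else lam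

lemma sigmaFinite_freeMeasure (lam : Measure Z) [SigmaFinite lam] {n : ℕ} (μd : Th → Z → ℝ)
    (θ : Th) (t : Fin (n + 1)) : SigmaFinite (freeMeasure lam μd θ t) := by
  unfold freeMeasure
  split_ifs
  · exact SigmaFinite.withDensity_ofReal _
  · infer_instance

/-- The reference measure of `m` free particles at each time. -/
def freeLaw (lam : Measure Z) (n m : ℕ) (μd : Th → Z → ℝ) (θ : Th) :
    Measure (Fin (n + 1) → Fin m → Z) :=
  Measure.pi fun t => Measure.pi fun _ => freeMeasure lam μd θ t

lemma sigmaFinite_freeLaw (lam : Measure Z) [SigmaFinite lam] (n m : ℕ) (μd : Th → Z → ℝ)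
    (θ : Th) : SigmaFinite (freeLaw lam n m μd θ) := by
  have := sigmaFinite_freeMeasure lam (n := n) μd θ
  unfold freeLaw
  infer_instance

lemma lintegral_condBase (lam : Measure Z) [SigmaFinite lam] {n m : ℕ} (μd : Th → Z → ℝ)
    (θ : Th) (z : Fin (n + 1) → Z) (k : Fin (n + 1) → Fin (m + 1))
    {H : (Fin (n + 1) → Fin (m + 1) → Z) → ℝ≥0∞} (hH : Measurable H) :
    ∫⁻ ζ, H ζ ∂(condBase lam μd θ z k)
      = ∫⁻ u, H (insertPath k (z, u)) ∂(freeLaw lam n m μd θ) := by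
  have := sigmaFinite_freeMeasure lam (n := n) μd θ
  have := sigmaFinite_freeLaw lam n m μd θ
  have h := measurePreserving_insertPath k (fun t => Measure.dirac (z t)) (freeMeasure lam μd θ)
  rw [pi_dirac] at h
  refine (h.lintegral_comp hH).symm.trans ?_
  change ∫⁻ a, _ ∂((Measure.dirac z).prod (freeLaw lam n m μd θ)) = _
  rw [Measure.dirac_prod]
  exact lintegral_map (hH.comp h.measurable) measurable_prodMk_left

lemma measurable_insertPath {n m : ℕ} (k : Fin (n + 1) → Fin (m + 1)) :
    Measurable (insertPath (Z := Z) k) :=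
  (measurePreserving_insertPath k (fun _ => 0) fun _ => 0).measurable

lemma measurable_lintegral_condBase (lam : Measure Z) [SigmaFinite lam] {n m : ℕ}
    (μd : Th → Z → ℝ) (θ : Th) (k : Fin (n + 1) → Fin (m + 1))
    {H : (Fin (n + 1) → Fin (m + 1) → Z) → ℝ≥0∞} (hH : Measurable H) :
    Measurable fun z => ∫⁻ ζ, H ζ ∂(condBase lam μd θ z k) := by
  have := sigmaFinite_freeLaw lam n m μd θ
  simp only [lintegral_condBase lam μd θ _ k hH]
  exact (hH.comp (measurable_insertPath k)).lintegral_prod_right'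

lemma insertPath_apply_slot {Z : Type*} {n m : ℕ} (k : Fin (n + 1) → Fin (m + 1))
    (z : Fin (n + 1) → Z) (u : Fin (n + 1) → Fin m → Z) :
    (fun t => insertPath k (z, u) t (k t)) = z := by
  funext t
  simp [insertPath]

lemma lintegral_pathWeight_condBase (lam : Measure Z) [SigmaFinite lam] {n m : ℕ}
    (μd : Th → Z → ℝ) (f : Th → Z → Z → ℝ) (w : Th → Fin (n + 1) → Z → ℝ) (θ : Th)
    (hfm : Measurable (Function.uncurry (f θ)))
    (hwm : ∀ t, Measurable (w θ t)) (hfpos : ∀ x y, 0 < f θ x y) (hwpos : ∀ t x, 0 < w θ t x)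
    (k : Fin (n + 1) → Fin (m + 1))
    {Ψ : (Fin (n + 1) → Fin (m + 1) → Z) → ℝ≥0∞} (hΨ : Measurable Ψ) :
    ∫⁻ z, pathWeight f w θ z * ∫⁻ ζ, condDens f w θ k ζ * Ψ ζ ∂(condBase lam μd θ z k)
        ∂(Measure.pi (freeMeasure lam μd θ))
      = ∫⁻ ζ, smcWeight f w θ ζ * bsProb f w θ k ζ * Ψ ζ ∂(freeLaw lam n (m + 1) μd θ) := by
  have := sigmaFinite_freeMeasure lam (n := n) μd θ
  have := sigmaFinite_freeLaw lam n m μd θ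
  have hD := measurable_condDens f w θ hfm hwm k
  have hP := measurable_pathWeight f w θ hfm hwm
  have h := measurePreserving_insertPath k (freeMeasure lam μd θ) (freeMeasure lam μd θ)
  have hG : Measurable fun ζ : Fin (n + 1) → Fin (m + 1) → Z =>
      smcWeight f w θ ζ * bsProb f w θ k ζ * Ψ ζ :=
    ((measurable_smcWeight f w θ hfm hwm).mul (measurable_bsProb f w θ hfm hwm k)).mul hΨ
  simp only [ite_self] at h
  rw [freeLaw, ← h.lintegral_comp hG, lintegral_prod _
    (by simpa only [Function.comp_def] using (hG.comp h.measurable).aemeasurable)]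
  refine lintegral_congr fun z => ?_
  rw [lintegral_condBase lam μd θ z k (hD.fun_mul hΨ), ← lintegral_const_mul _
    ((hD.fun_mul hΨ).fun_comp ((measurable_insertPath k).fun_comp measurable_prodMk_left))]
  refine lintegral_congr fun u => ?_
  rw [← pathWeight_mul_condDens f w θ hfpos hwpos k, insertPath_apply_slot, mul_assoc]

lemma lintegral_condDens (lam : Measure Z) [SigmaFinite lam] {n m : ℕ}
    (μd : Th → Z → ℝ) (f : Th → Z → Z → ℝ) (w : Th → Fin (n + 1) → Z → ℝ) (θ : Th)
    (hfm : Measurable (Function.uncurry (f θ)))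
    (hwm : ∀ t, Measurable (w θ t)) (hwpos : ∀ t x, 0 < w θ t x)
    (hμdint : ∫⁻ x, ENNReal.ofReal (μd θ x) ∂lam = 1)
    (hfint : ∀ x, ∫⁻ y, ENNReal.ofReal (f θ x y) ∂lam = 1)
    (z : Fin (n + 1) → Z) (k : Fin (n + 1) → Fin (m + 1)) :
    ∫⁻ ζ, condDens f w θ k ζ ∂(condBase lam μd θ z k) = 1 := by
  have hσ := sigmaFinite_freeMeasure lam (n := n) μd θ
  have hσ' : ∀ t i, SigmaFinite (if i = k t then Measure.dirac (z t)
      else freeMeasure lam μd θ t) := fun t i => by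
    split_ifs <;> infer_instance
  refine lintegral_pi_chain_eq_one (fun t => Measure.pi fun i =>
    if i = k t then Measure.dirac (z t) else freeMeasure lam μd θ t) ?_
    (fun s x y => ∏ i : Fin (m + 1), if i = k s.succ then 1 else
      (∑ j : Fin (m + 1), ENNReal.ofReal (w θ s.castSucc (x j))
          * ENNReal.ofReal (f θ (x j) (y i)))
        / ∑ j : Fin (m + 1), ENNReal.ofReal (w θ s.castSucc (x j))) ?_ ?_
  · rw [Measure.pi_univ]
    refine Finset.prod_eq_one fun i _ => ?_
    split_ifs
    · simp
    · simp [freeMeasure, hμdint]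
  · intro s
    refine Finset.measurable_prod _ fun i _ => ?_
    split_ifs
    · exact measurable_const
    · fun_prop
  · intro s x
    have hm : ∀ j, Measurable fun y => ENNReal.ofReal (w θ s.castSucc (x j))
        * ENNReal.ofReal (f θ (x j) y) := fun j => by fun_prop
    rw [lintegral_pi_prod (ν := fun i => if i = k s.succ then Measure.dirac (z s.succ)
      else freeMeasure lam μd θ s.succ) (g := fun i y => if i = k s.succ then 1 else
      (∑ j : Fin (m + 1), ENNReal.ofReal (w θ s.castSucc (x j)) * ENNReal.ofReal (f θ (x j) y))
        / ∑ j : Fin (m + 1), ENNReal.ofReal (w θ s.castSucc (x j)))]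
    · refine Finset.prod_eq_one fun i _ => ?_
      split_ifs
      · simp
      · simp only [div_eq_mul_inv, freeMeasure, Fin.succ_ne_zero, if_false]
        rw [lintegral_mul_const _ (Finset.measurable_sum _ fun j _ => hm j),
          lintegral_finsetSum _ fun j _ => hm j]
        have : ∀ j, ∫⁻ y, ENNReal.ofReal (w θ s.castSucc (x j)) * ENNReal.ofReal (f θ (x j) y) ∂lam
            = ENNReal.ofReal (w θ s.castSucc (x j)) := fun j => by
          rw [lintegral_const_mul _ (by fun_prop), hfint, mul_one]
        simp only [this]
        exact ENNReal.mul_inv_cancel (sum_ofReal_ne_zero 0 _ fun j => hwpos _ _)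
          (ENNReal.sum_ne_top.2 fun _ _ => ENNReal.ofReal_ne_top)
    · intro i
      split_ifs
      · exact measurable_const
      · exact (Finset.measurable_sum _ fun j _ => hm j).div measurable_const

lemma lintegral_condDens_mul_slot (lam : Measure Z) [SigmaFinite lam] {n m : ℕ}
    (μd : Th → Z → ℝ) (f : Th → Z → Z → ℝ) (w : Th → Fin (n + 1) → Z → ℝ) (θ : Th)
    (hfm : Measurable (Function.uncurry (f θ)))
    (hwm : ∀ t, Measurable (w θ t)) (hwpos : ∀ t x, 0 < w θ t x)
    (hμdint : ∫⁻ x, ENNReal.ofReal (μd θ x) ∂lam = 1)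
    (hfint : ∀ x, ∫⁻ y, ENNReal.ofReal (f θ x y) ∂lam = 1)
    (z : Fin (n + 1) → Z) (k : Fin (n + 1) → Fin (m + 1))
    {G : (Fin (n + 1) → Z) → ℝ≥0∞} (hG : Measurable G) :
    ∫⁻ ζ, condDens f w θ k ζ * G (fun t => ζ t (k t)) ∂(condBase lam μd θ z k) = G z := by
  have hD := measurable_condDens f w θ hfm hwm k
  have hG' : Measurable fun ζ : Fin (n + 1) → Fin (m + 1) → Z => G fun t => ζ t (k t) :=
    hG.comp (by fun_prop)
  rw [lintegral_condBase lam μd θ z k (hD.fun_mul hG')]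
  simp only [insertPath_apply_slot]
  rw [lintegral_mul_const _ (hD.fun_comp ((measurable_insertPath k).fun_comp measurable_prodMk_left)),
    ← lintegral_condBase lam μd θ z k hD,
    lintegral_condDens lam μd f w θ hfm hwm hwpos hμdint hfint z k, one_mul]

/-- **Unbiasedness of the conditional-SMC/backward-sampling estimator of the marginal
Metropolis–Hastings acceptance ratio (Theorem 3 /
`thm: SMC unbiased estimator of acceptance ratio` of Andrieu, Doucet, Yıldırım & Chopin):**
if `z ∼ π_θ` and, given `z`, `ζ ∼ Φ_{θ̃}(z, ·)` is produced by the conditional SMC algorithm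
with `M` particles at parameter `θ̃` conditioned on `z`, then
`E[ ∑_k φ_{θ̃}(k∣ζ) r̊_{z,ζ^{(k)}}(θ,θ';θ̃) ] = r(θ,θ') = [q(θ',θ)η(θ')ℓ_{θ'}]/[q(θ,θ')η(θ)ℓ_θ]`. -/
theorem csmc_acceptance_ratio_unbiased
    (lam : Measure Z) [SigmaFinite lam] (n M : ℕ) (hM : 1 ≤ M)
    (μd : Th → Z → ℝ) (hμdm : ∀ θ, Measurable (μd θ)) (hμdpos : ∀ θ x, 0 < μd θ x)
    (f : Th → Z → Z → ℝ) (hfm : ∀ θ, Measurable (Function.uncurry (f θ)))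
    (hfpos : ∀ θ x y, 0 < f θ x y)
    (w : Th → Fin (n + 1) → Z → ℝ) (hwm : ∀ θ t, Measurable (w θ t))
    (hwpos : ∀ θ t x, 0 < w θ t x)
    (hμdint : ∀ θ, ∫⁻ x, ENNReal.ofReal (μd θ x) ∂lam = 1)
    (hfint : ∀ θ x, ∫⁻ y, ENNReal.ofReal (f θ x y) ∂lam = 1)
    (qp : Th → Th → ℝ) (hqp : ∀ a b, 0 < qp a b)
    (ηp : Th → ℝ) (hηp : ∀ a, 0 < ηp a)
    (L : Th → ℝ≥0∞)
    (hL : ∀ θ, L θ = ∫⁻ z, ENNReal.ofReal (gam μd f w θ z)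
      ∂(Measure.pi (fun _ : Fin (n + 1) => lam)))
    (hLpos : ∀ θ, 0 < L θ) (hLfin : ∀ θ, L θ ≠ ⊤)
    (θ θ' θt : Th) :
    ∫⁻ z, ∫⁻ ζ, (∑ k : Fin (n + 1) → Fin M,
          bsProb f w θt k ζ
            * ENNReal.ofReal (rEst μd f w qp ηp θ θ' θt z (fun t => ζ t (k t))))
        ∂(csmcLaw lam M μd f w θt z) ∂(post lam μd f w L θ)
      = ENNReal.ofReal (qp θ' θ * ηp θ') * L θ'
          / (ENNReal.ofReal (qp θ θ' * ηp θ) * L θ) := by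
  obtain ⟨m, rfl⟩ : ∃ m, M = m + 1 := ⟨M - 1, by omega⟩
  have hgam := fun a => measurable_gam μd f w a (hμdm a) (hfm a) (hwm a)
  have hpos := fun a => gam_pos μd f w a (hμdpos a) (hfpos a) (hwpos a)
  have hB := fun k : Fin (n + 1) → Fin (m + 1) => measurable_bsProb f w θt (hfm θt) (hwm θt) k
  have hD := fun k : Fin (n + 1) → Fin (m + 1) => measurable_condDens f w θt (hfm θt) (hwm θt) k
  have hP := measurable_pathWeight f w θt (hfm θt) (hwm θt)
  have hC := measurable_smcWeight (M := m + 1) f w θt (hfm θt) (hwm θt)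
  set N : ℝ≥0∞ := (((m + 1 : ℕ) : ℝ≥0∞) ^ (n + 1))⁻¹ with hN
  set G : (Fin (n + 1) → Z) → ℝ≥0∞ := fun z =>
    ENNReal.ofReal (gam μd f w θ' z / gam μd f w θt z) with hGdef
  have hG : Measurable G := ((hgam θ').div (hgam θt)).ennreal_ofReal
  have hGk : ∀ k : Fin (n + 1) → Fin (m + 1),
      Measurable fun ζ : Fin (n + 1) → Fin (m + 1) → Z => G fun t => ζ t (k t) :=
    fun k => hG.comp (by fun_prop)
  set Ψ : (Fin (n + 1) → Fin (m + 1) → Z) → ℝ≥0∞ := fun ζ =>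
    ∑ k, bsProb f w θt k ζ * G (fun t => ζ t (k t)) with hΨdef
  have hΨ : Measurable Ψ := Finset.measurable_sum _ fun k _ => (hB k).mul (hGk k)
  set c : ℝ := (qp θ' θ * ηp θ') / (qp θ θ' * ηp θ) with hc
  have hc0 : 0 < c := div_pos (mul_pos (hqp _ _) (hηp _)) (mul_pos (hqp _ _) (hηp _))
  have hr : ∀ z z', ENNReal.ofReal (rEst μd f w qp ηp θ θ' θt z z')
      = ENNReal.ofReal (c * (gam μd f w θt z / gam μd f w θ z)) * G z' := fun z z' => by
    rw [hGdef, ← ENNReal.ofReal_mul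
      (mul_nonneg hc0.le (div_pos (hpos θt z) (hpos θ z)).le), rEst, hc]
    congr 1
    have h1 := (hpos θ z).ne'
    have h2 := (hpos θt z').ne'
    have h3 := (hqp θ θ').ne'
    have h4 := (hηp θ).ne'
    field_simp
  have hinner : ∀ z, ∫⁻ ζ, (∑ k : Fin (n + 1) → Fin (m + 1),
        bsProb f w θt k ζ
          * ENNReal.ofReal (rEst μd f w qp ηp θ θ' θt z (fun t => ζ t (k t))))
        ∂(csmcLaw lam (m + 1) μd f w θt z)
      = ENNReal.ofReal (c * (gam μd f w θt z / gam μd f w θ z)) *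
        ∑ k, N * ∫⁻ ζ, condDens f w θt k ζ * Ψ ζ ∂(condBase lam μd θt z k) := fun z => by
    simp only [hr, mul_left_comm (bsProb f w θt _ _), ← Finset.mul_sum]
    rw [lintegral_const_mul _ hΨ, csmcLaw, lintegral_finsetSum_measure]
    refine congrArg (ENNReal.ofReal (c * (gam μd f w θt z / gam μd f w θ z)) * ·) ?_
    rw [Finset.mul_sum]
    refine Finset.sum_congr rfl fun k _ => ?_
    rw [lintegral_smul_measure, lintegral_withDensity_eq_lintegral_mul _ (hD k) hΨ]
    rfl
  have hJ : ∀ k, Measurable fun z =>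
      ∫⁻ ζ, condDens f w θt k ζ * Ψ ζ ∂(condBase lam μd θt z k) := fun k =>
    measurable_lintegral_condBase lam μd θt k ((hD k).fun_mul hΨ)
  have hdens : ∀ z, ENNReal.ofReal (gam μd f w θ z) / L θ
      * ENNReal.ofReal (c * (gam μd f w θt z / gam μd f w θ z))
      = ENNReal.ofReal c / L θ * (ENNReal.ofReal (μd θt (z 0)) * pathWeight f w θt z) := fun z => by
    have h1 : gam μd f w θ z * (c * (gam μd f w θt z / gam μd f w θ z))
        = c * gam μd f w θt z := by
      have := (hpos θ z).ne'
      field_simp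
    rw [← ofReal_gam μd f w θt (hμdpos θt) (hfpos θt) (hwpos θt), div_eq_mul_inv _ (L θ),
      div_eq_mul_inv _ (L θ), mul_right_comm, mul_right_comm _ _ (ENNReal.ofReal (gam μd f w θt z)),
      ← ENNReal.ofReal_mul (hpos θ z).le, ← ENNReal.ofReal_mul hc0.le, h1]
  have hmass : ∀ l : Fin (n + 1) → Fin (m + 1),
      ∫⁻ ζ, smcWeight f w θt ζ * bsProb f w θt l ζ * G (fun t => ζ t (l t))
        ∂(freeLaw lam n (m + 1) μd θt) = L θ' := fun l => by
    rw [← lintegral_pathWeight_condBase lam μd f w θt (hfm θt) (hwm θt) (hfpos θt) (hwpos θt) l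
      (hGk l)]
    simp only [lintegral_condDens_mul_slot lam μd f w θt (hfm θt) (hwm θt) (hwpos θt) (hμdint θt)
      (hfint θt) _ l hG]
    refine (lintegral_pi_withDensity_zero lam _ (hμdm θt).ennreal_ofReal _ (hP.mul hG)).trans ?_
    rw [hL θ']
    refine lintegral_congr fun z => ?_
    rw [Pi.mul_apply, ← mul_assoc, ← ofReal_gam μd f w θt (hμdpos θt) (hfpos θt) (hwpos θt), hGdef,
      ← ENNReal.ofReal_mul (hpos θt z).le, mul_div_cancel₀ _ (hpos θt z).ne']
  have hsum : ∑ k, ∫⁻ ζ, smcWeight f w θt ζ * bsProb f w θt k ζ * Ψ ζ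
      ∂(freeLaw lam n (m + 1) μd θt)
      = ∑ l : Fin (n + 1) → Fin (m + 1), L θ' := by
    rw [← lintegral_finsetSum _ fun k _ => (hC.fun_mul (hB k)).fun_mul hΨ,
      ← Finset.sum_congr rfl fun l _ => hmass l,
      ← lintegral_finsetSum _ fun l _ => (hC.fun_mul (hB l)).fun_mul (hGk l)]
    refine lintegral_congr fun ζ => ?_
    rw [← Finset.sum_mul, ← Finset.mul_sum,
      sum_bsProb hM f w θt (hfpos θt) (hwpos θt), mul_one, hΨdef, Finset.mul_sum]
    simp only [mul_assoc]
  calc _ = ∫⁻ z, ENNReal.ofReal c / L θ * (ENNReal.ofReal (μd θt (z 0)) *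
          (pathWeight f w θt z *
            ∑ k, N * ∫⁻ ζ, condDens f w θt k ζ * Ψ ζ ∂(condBase lam μd θt z k)))
          ∂(Measure.pi fun _ : Fin (n + 1) => lam) := by
        simp only [hinner]
        rw [post, lintegral_withDensity_eq_lintegral_mul_non_measurable _
          ((hgam θ).ennreal_ofReal.div_const _)
          (Filter.Eventually.of_forall fun z =>
            ENNReal.div_lt_top ENNReal.ofReal_ne_top (hLpos θ).ne')]
        refine lintegral_congr fun z => ?_
        rw [Pi.mul_apply, ← mul_assoc, hdens]
        simp only [mul_assoc]
    _ = ENNReal.ofReal c / L θ * ∫⁻ z, pathWeight f w θt z *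
            ∑ k, N * ∫⁻ ζ, condDens f w θt k ζ * Ψ ζ ∂(condBase lam μd θt z k)
          ∂(Measure.pi (freeMeasure lam μd θt)) := by
        have hF : Measurable fun z => pathWeight f w θt z *
            ∑ k, N * ∫⁻ ζ, condDens f w θt k ζ * Ψ ζ ∂(condBase lam μd θt z k) :=
          hP.mul (Finset.measurable_sum _ fun k _ => (hJ k).const_mul _)
        rw [lintegral_const_mul _
          (((hμdm θt).fun_comp (measurable_pi_apply 0)).ennreal_ofReal.fun_mul hF)]
        exact congrArg _ (lintegral_pi_withDensity_zero lam _ (hμdm θt).ennreal_ofReal _ hF).symm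
    _ = ENNReal.ofReal c / L θ * (N * ∑ k, ∫⁻ ζ, smcWeight f w θt ζ * bsProb f w θt k ζ * Ψ ζ
          ∂(freeLaw lam n (m + 1) μd θt)) := by
        simp only [Finset.mul_sum, mul_left_comm (pathWeight f w θt _) N]
        rw [lintegral_finsetSum _ fun k _ => (hP.fun_mul (hJ k)).const_mul N, Finset.mul_sum]
        refine Finset.sum_congr rfl fun k _ => ?_
        rw [lintegral_const_mul _ (hP.fun_mul (hJ k)), lintegral_pathWeight_condBase lam μd f w θt
          (hfm θt) (hwm θt) (hfpos θt) (hwpos θt) k hΨ]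
    _ = ENNReal.ofReal c / L θ * L θ' := by
        rw [hsum, Finset.sum_const, Finset.card_univ, Fintype.card_fun, Fintype.card_fin,
          Fintype.card_fin, nsmul_eq_mul, ← mul_assoc N, Nat.cast_pow, hN,
          ENNReal.inv_mul_cancel (by simp) (by simp), one_mul]
    _ = _ := by
        rw [hc, ENNReal.ofReal_div_of_pos (mul_pos (hqp _ _) (hηp _)), div_eq_mul_inv,
          div_eq_mul_inv, div_eq_mul_inv, ENNReal.mul_inv (Or.inr (hLfin θ))
          (Or.inr (hLpos θ).ne')]
        ring

end CSMCUnbiased
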